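/- arXiv:2104.11314 — 3 statements merged into one kernel-verified Lean document; each statement's English description precedes it below -/
import Mathlib

section
/- Let B > 0, R > 0, 0 < ν < 1, Ω > 0, and φ ∈ ℝ. Then for every δ > 0 the set of z ∈ (0, δ) satisfying B·R^{1−ν}·z^{ν}·sin(Ω·ln z + φ) = z is infinite. That is, under the Shilnikov condition ν < 1, the 1D return map z̄ = B R^{1−ν} z^{ν} sin(Ω ln z + φ) has countably many fixed points accumulating at z = 0. -/
/-- For `C > 0` and `ν < 1`, the map `z ↦ C z ^ ν sin (Ω log z + φ)` has a fixed point in every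
interval `(0, δ)`. -/
theorem exists_fixed_point_rpow_mul_sin_log {C ν Ω : ℝ} (φ : ℝ) (hC : 0 < C) (hν : ν < 1)
    (hΩ : 0 < Ω) {δ : ℝ} (hδ : 0 < δ) :
    ∃ z ∈ Set.Ioo 0 δ, C * z ^ ν * Real.sin (Ω * Real.log z + φ) = z := by
  obtain ⟨n, hn⟩ := exists_nat_gt
    ((Real.pi / 2 - φ - Ω * min (Real.log δ) (Real.log C / (1 - ν))) / (2 * Real.pi))
  rw [div_lt_iff₀ (by positivity)] at hn
  set s : ℝ := (-φ - n * (2 * Real.pi)) / Ω with hs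
  set t : ℝ := (Real.pi / 2 - φ - n * (2 * Real.pi)) / Ω with ht
  have hst : s ≤ t := by
    rw [hs, ht]
    gcongr
    linarith [Real.pi_pos]
  have htm : t < min (Real.log δ) (Real.log C / (1 - ν)) := by
    rw [ht, div_lt_iff₀ hΩ]
    linarith
  obtain ⟨htδ, htC⟩ := lt_min_iff.1 htm
  rw [lt_div_iff₀ (by linarith)] at htC
  have hsin_s : Real.sin (Ω * s + φ) = 0 := by
    have h : Ω * s + φ = 0 - n * (2 * Real.pi) := by
      rw [hs]
      field_simp
      ring
    rw [h, Real.sin_sub_nat_mul_two_pi, Real.sin_zero]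
  have hsin_t : Real.sin (Ω * t + φ) = 1 := by
    have h : Ω * t + φ = Real.pi / 2 - n * (2 * Real.pi) := by
      rw [ht]
      field_simp
      ring
    rw [h, Real.sin_sub_nat_mul_two_pi, Real.sin_pi_div_two]
  have hexp : Real.exp t ≤ C * Real.exp (t * ν) := by
    rw [← Real.exp_log hC, ← Real.exp_add, Real.exp_le_exp]
    linarith
  have hcont : ContinuousOn
      (fun x : ℝ => C * Real.exp (x * ν) * Real.sin (Ω * x + φ) - Real.exp x)
      (Set.Icc s t) := by
    fun_prop
  obtain ⟨x, hx, hx0⟩ := intermediate_value_Icc hst hcont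
    (show (0 : ℝ) ∈ Set.Icc _ _ by
      constructor
      · simp only [hsin_s]
        linarith [Real.exp_pos s]
      · simp only [hsin_t]
        linarith)
  refine ⟨Real.exp x, ⟨Real.exp_pos x, ?_⟩, ?_⟩
  · exact (Real.lt_log_iff_exp_lt hδ).1 (hx.2.trans_lt htδ)
  · rw [← Real.exp_mul, Real.log_exp]
    exact sub_eq_zero.1 hx0

/-- Under the Shilnikov condition ν < 1, the 1D return map
z̄ = B R^{1−ν} z^{ν} sin(Ω ln z + φ) has countably many fixed points accumulating at z = 0. -/
theorem shilnikov_fixed_points_accumulate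
    (B R ν Ω φ : ℝ) (hB : 0 < B) (hR : 0 < R) (hν0 : 0 < ν) (hν1 : ν < 1)
    (hΩ : 0 < Ω) :
    ∀ δ : ℝ, 0 < δ →
      {z : ℝ | z ∈ Set.Ioo 0 δ ∧
        B * R ^ (1 - ν) * z ^ ν * Real.sin (Ω * Real.log z + φ) = z}.Infinite := by
  intro δ hδ hfin
  have hC : 0 < B * R ^ (1 - ν) := by positivity
  obtain ⟨z₀, hz₀, heq₀⟩ := exists_fixed_point_rpow_mul_sin_log φ hC hν1 hΩ hδ
  obtain ⟨m, ⟨hm, -⟩, hmin⟩ := Set.exists_min_image _ id hfin ⟨z₀, hz₀, heq₀⟩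
  obtain ⟨z, hz, heq⟩ := exists_fixed_point_rpow_mul_sin_log φ hC hν1 hΩ hm.1
  exact (hmin z ⟨⟨hz.1, hz.2.trans hm.2⟩, heq⟩).not_gt hz.2
end

section
/- Let a, b, λ, ω be real numbers with a ≠ 3. Suppose the characteristic polynomial of the Jacobian of the smooth Chua model at the origin factors as X³ + (1 − a/6)X² + (b − 7a/6)X − ab/6 = (X − λ)·(X² + 2λX + λ² + ω²) (equality of real polynomials), i.e., the origin is a neutral saddle-focus with eigenvalues λ and −λ ± iω (zero saddle value σ₁ = 0, saddle index ν = 1). Then b = (a² − 33a + 36)(a − 6)/(36(3 − a)). This is the NSF curve of the Chua model in the (a, b)-parameter plane. -/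
open Polynomial

/-- The NSF (neutral saddle-focus) curve of the smooth Chua model in the
(a, b)-parameter plane: b = (a² − 33a + 36)(a − 6)/(36(3 − a)). -/
theorem chua_NSF_curve (a b lam ω : ℝ) (ha : a ≠ 3)
    (hfac : (X ^ 3 + C (1 - a / 6) * X ^ 2 + C (b - 7 * a / 6) * X - C (a * b / 6) : ℝ[X]) =
      (X - C lam) * (X ^ 2 + C (2 * lam) * X + C (lam ^ 2 + ω ^ 2))) :
    b = (a ^ 2 - 33 * a + 36) * (a - 6) / (36 * (3 - a)) := by
  have key (x : ℝ) : x ^ 3 + (1 - a / 6) * x ^ 2 + (b - 7 * a / 6) * x - a * b / 6 =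
      (x - lam) * (x ^ 2 + 2 * lam * x + (lam ^ 2 + ω ^ 2)) := by
    simpa using congrArg (eval x) hfac
  have h0 := key 0
  have h1 := key 1
  have h2 := key (-1)
  have hlam : lam = 1 - a / 6 := by linarith
  have hω : ω ^ 2 = b - 7 * a / 6 + lam ^ 2 := by linarith
  have ha' : 3 - a ≠ 0 := sub_ne_zero.mpr ha.symm
  rw [hω, hlam] at h0
  rw [eq_div_iff (mul_ne_zero (by norm_num) ha')]
  linear_combination 108 * h0
end

section
/- Let a, b, λ, ρ, ω, ξ be real numbers with ξ ≠ 1/2 and a·ξ ≠ 3, and suppose ρ = ξ·λ and the characteristic polynomial of the Jacobian of the smooth Chua model at the origin factors as X³ + (1 − a/6)X² + (b − 7a/6)X − ab/6 = (X − λ)·(X² + 2ρX + ρ² + ω²) (equality of real polynomials), i.e., the origin is a saddle-focus with eigenvalues λ and −ρ ± iω and saddle index ν = ρ/λ = ξ. Then b = (7a(a − 6)/12 − ξ(a − 6)³/(36(1 − 2ξ)²))/(aξ − 3). This is the curve ν = ξ of constant saddle index of the Chua model in the (a, b)-parameter plane. -/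
open Polynomial

/-- The curve ν = ξ of constant saddle index of the smooth Chua model in the
(a, b)-parameter plane. -/
theorem chua_constant_saddle_index_curve (a b lam ρ ω ξ : ℝ)
    (hξ : ξ ≠ 1 / 2) (haξ : a * ξ ≠ 3) (hρ : ρ = ξ * lam)
    (hfac : (X ^ 3 + C (1 - a / 6) * X ^ 2 + C (b - 7 * a / 6) * X - C (a * b / 6) : ℝ[X]) =
      (X - C lam) * (X ^ 2 + C (2 * ρ) * X + C (ρ ^ 2 + ω ^ 2))) :
    b = (7 * a * (a - 6) / 12 - ξ * (a - 6) ^ 3 / (36 * (1 - 2 * ξ) ^ 2)) / (a * ξ - 3) := by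
  have h0 := congrArg (eval 0) hfac
  have h1 := congrArg (eval 1) hfac
  have h2 := congrArg (eval (-1)) hfac
  simp only [eval_add, eval_sub, eval_mul, eval_pow, eval_X, eval_C] at h0 h1 h2
  subst hρ
  have hd : 1 - 2 * ξ ≠ 0 := fun h => hξ (by linarith)
  have ha : a - 6 = 6 * lam * (1 - 2 * ξ) := by linarith
  have hc : b - 7 * a / 6 = (ξ * lam) ^ 2 + ω ^ 2 - 2 * ξ * lam ^ 2 := by linarith
  have hn : a * b / 6 = lam * ((ξ * lam) ^ 2 + ω ^ 2) := by linarith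
  have hcube : ξ * (a - 6) ^ 3 / (36 * (1 - 2 * ξ) ^ 2) = 6 * ξ * lam ^ 3 * (1 - 2 * ξ) := by
    rw [ha]
    field_simp
    ring
  rw [hcube, eq_div_iff (sub_ne_zero.mpr haξ)]
  linear_combination (b / 2 - 7 * a / 12) * ha + 3 * (1 - 2 * ξ) * (lam * hc - hn)
end
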